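/- arXiv:2504.06589 — 6 statements merged into one kernel-verified Lean document; each statement's English description precedes it below -/
import Mathlib

section
/- Dictators and the Fixed-Point Property: In the Self-Reference System (w, +_i), the Social Welfare Function w has a dictator at individual i if and only if for every profile p ∈ P^N the fixed-point property is satisfied by p itself, i.e., p ∗ p = p, where p ∗ q := the tuple obtained from p by replacing coordinate i with p_i + w(q). -/
/-- A weak order on `A`: a transitive and complete (total) binary relation. -/
structure WeakOrder (A : Type*) where
  rel : A → A → Prop
  trans : ∀ a b c, rel a b → rel b c → rel a c
  total : ∀ a b, rel a b ∨ rel b a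

namespace WeakOrder

/-- Strict preference: `a ≺ b` in `r`. -/
def strict {A : Type*} (r : WeakOrder A) (a b : A) : Prop := r.rel a b ∧ ¬ r.rel b a

/-- The reversed (converse) weak order. -/
def reverse {A : Type*} (r : WeakOrder A) : WeakOrder A :=
  ⟨fun a b => r.rel b a, fun a b c h1 h2 => r.trans c b a h2 h1, fun a b => r.total b a⟩

end WeakOrder

/-- The totally indifferent weak order `𝐢`. -/
def indiff (A : Type*) : WeakOrder A :=
  ⟨fun _ _ => True, fun _ _ _ _ _ => trivial, fun _ _ => Or.inl trivial⟩

/-- The strictness ordering on weak orders: `r ≤ s` iff every strict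
preference of `s` is a strict preference of `r`. -/
def strLE {A : Type*} (r s : WeakOrder A) : Prop :=
  ∀ a b, s.strict a b → r.strict a b

/-- `P̄ = P ∪ {𝐜}`, with `none` playing the role of the contradictory
preference cycle `𝐜` and `some r` the weak order `r`. -/
abbrev Pbar (A : Type*) := Option (WeakOrder A)

/-- The strictness ordering extended to `P̄`, with `𝐜 = none` as bottom. -/
def barLE {A : Type*} : Pbar A → Pbar A → Prop
  | none, _ => True
  | some _, none => False
  | some r, some s => strLE r s

/-- `t` is a greatest lower bound of `r` and `s` in `(P̄, ≤)`. -/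
def IsGLBbar {A : Type*} (r s t : Pbar A) : Prop :=
  barLE t r ∧ barLE t s ∧ ∀ u, barLE u r → barLE u s → barLE u t

/-- `t` is a least upper bound of `r` and `s` in `(P̄, ≤)`. -/
def IsLUBbar {A : Type*} (r s t : Pbar A) : Prop :=
  barLE r t ∧ barLE s t ∧ ∀ u, barLE r u → barLE s u → barLE t u

open Classical in
/-- `r ⊓ s`: the greatest lower bound of `r` and `s` in `(P̄, ≤)` (which always
exists; `𝐜` as a default value otherwise). -/
noncomputable def pinf {A : Type*} (r s : Pbar A) : Pbar A :=
  if h : ∃ t, IsGLBbar r s t then h.choose else none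

/-- `t` is a least upper bound of the weak orders `r` and `s` in the
strictness ordering on `P`. -/
def IsLUBw {A : Type*} (r s t : WeakOrder A) : Prop :=
  strLE r t ∧ strLE s t ∧ ∀ u, strLE r u → strLE s u → strLE t u

/-- `t` is a greatest lower bound of the weak orders `r` and `s` in the
strictness ordering on `P`. -/
def IsGLBw {A : Type*} (r s t : WeakOrder A) : Prop :=
  strLE t r ∧ strLE t s ∧ ∀ u, strLE u r → strLE u s → strLE u t

open Classical in
/-- `r ⊔ s`: the least upper bound of two weak orders in the strictness
ordering (which always exists; default value otherwise). -/
noncomputable def wsup {A : Type*} (r s : WeakOrder A) : WeakOrder A :=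
  if h : ∃ t, IsLUBw r s t then h.choose else indiff A

/-- The join `+ : P̄ × P̄ → P̄`: `r + s = r ⊔ s` when both are weak orders,
and `𝐢` otherwise. -/
noncomputable def pjoin {A : Type*} : Pbar A → Pbar A → Pbar A
  | some r, some s => some (wsup r s)
  | _, _ => some (indiff A)

open Classical in
/-- Negation on `P̄`: `¬𝐜 = 𝐢`, `¬𝐢 = 𝐜`, and otherwise the weak order with
all strict preferences reversed. -/
noncomputable def pneg {A : Type*} : Pbar A → Pbar A
  | none => some (indiff A)
  | some r => if r = indiff A then none else some r.reverse

/-- The inclusion `P^N ⊆ P̄^N` of profiles of weak orders. -/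
def coeP {A : Type*} {N : ℕ} (p : Fin N → WeakOrder A) : Fin N → Pbar A :=
  fun j => some (p j)

/-- `w` has a dictator at individual `i`. -/
def HasDictatorAt {A : Type*} {N : ℕ} (w : (Fin N → Pbar A) → Pbar A) (i : Fin N) : Prop :=
  ∀ p : Fin N → WeakOrder A,
    (w (coeP p) = none → p i = indiff A) ∧
    (p i ≠ indiff A → barLE (w (coeP p)) (some (p i)))

/-- The application function `Ω_i`. -/
noncomputable def Omega {A : Type*} {N : ℕ} (i : Fin N) (p : Fin N → Pbar A) (r : Pbar A) :
    Fin N → Pbar A :=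
  fun j => if j = i then pinf (p i) r else none

/-- The `i`-th indicator `Υ_i`: `𝐢` in coordinate `i` and `𝐜` elsewhere. -/
def indicator {A : Type*} {N : ℕ} (i : Fin N) : Fin N → Pbar A :=
  fun j => if j = i then some (indiff A) else none

/-- Coordinatewise negation on tuples. -/
noncomputable def negT {A : Type*} {N : ℕ} (p : Fin N → Pbar A) : Fin N → Pbar A :=
  fun j => pneg (p j)

/-- Coordinatewise extended strictness order on tuples. -/
def leT {A : Type*} {N : ℕ} (s t : Fin N → Pbar A) : Prop :=
  ∀ j, barLE (s j) (t j)

/-- `p ∗ q := Ω_i(p, w(q))` in the Self-Reference System `(w, Ω_i)`. -/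
noncomputable def starOmega {A : Type*} {N : ℕ} (w : (Fin N → Pbar A) → Pbar A) (i : Fin N)
    (p q : Fin N → Pbar A) : Fin N → Pbar A :=
  Omega i p (w q)

/-- Two tuples are consistent (`s ⋈ t`) iff `s_j ⊓ t_j ≠ 𝐜` in every coordinate. -/
def Consistent {A : Type*} {N : ℕ} (s t : Fin N → Pbar A) : Prop :=
  ∀ j, pinf (s j) (t j) ≠ none

/-- `(Υ, d)` satisfies quasi-consistency in `(w, Ω_i)`: `d ≤ ¬(Υ ∗ ¬d)`. -/
noncomputable def QuasiConsistent {A : Type*} {N : ℕ} (w : (Fin N → Pbar A) → Pbar A)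
    (i : Fin N) (Υ d : Fin N → Pbar A) : Prop :=
  leT d (negT (starOmega w i Υ (negT d)))

/-- `d` is a quasi-Gödel sentence w.r.t. `Υ` in `(w, Ω_i)`: `d ≤ ¬(Υ ∗ d)`. -/
noncomputable def QuasiGodelSentence {A : Type*} {N : ℕ} (w : (Fin N → Pbar A) → Pbar A)
    (i : Fin N) (Υ d : Fin N → Pbar A) : Prop :=
  leT d (negT (starOmega w i Υ d))

/-- `(Υ, d)` satisfies quasi-completeness in `(w, Ω_i)`:
`¬(Υ ∗ d)` and `¬(Υ ∗ ¬d)` are inconsistent. -/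
noncomputable def QuasiComplete {A : Type*} {N : ℕ} (w : (Fin N → Pbar A) → Pbar A)
    (i : Fin N) (Υ d : Fin N → Pbar A) : Prop :=
  ¬ Consistent (negT (starOmega w i Υ d)) (negT (starOmega w i Υ (negT d)))

/-- `(w, Ω_i)` is a quasi-Gödelian system with respect to `Υ`. -/
noncomputable def QuasiGodelian {A : Type*} {N : ℕ} (w : (Fin N → Pbar A) → Pbar A)
    (i : Fin N) (Υ : Fin N → Pbar A) : Prop :=
  ∃ d : Fin N → WeakOrder A,
    QuasiGodelSentence w i Υ (coeP d) ∧
    ¬ (QuasiConsistent w i Υ (coeP d) ∧ QuasiComplete w i Υ (coeP d))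

/-- `a ≺ b` in `x ∈ P̄` (`𝐜` is regarded as containing every strict preference). -/
def strictIn {A : Type*} (x : Pbar A) (a b : A) : Prop :=
  match x with
  | none => True
  | some r => r.strict a b

/-- Unanimity for an extended Social Welfare Function. -/
def Unanimity {A : Type*} {N : ℕ} (w : (Fin N → Pbar A) → Pbar A) : Prop :=
  ∀ (p : Fin N → WeakOrder A) (a b : A),
    (∀ j, (p j).strict a b) → strictIn (w (coeP p)) a b

/-- Independence of Irrelevant Alternatives for an extended Social Welfare Function. -/
def IIA {A : Type*} {N : ℕ} (w : (Fin N → Pbar A) → Pbar A) : Prop :=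
  ∀ (p q : Fin N → WeakOrder A) (a b : A),
    (∀ j, ((p j).strict a b ↔ (q j).strict a b) ∧ ((p j).strict b a ↔ (q j).strict b a)) →
    ((strictIn (w (coeP p)) a b ↔ strictIn (w (coeP q)) a b) ∧
     (strictIn (w (coeP p)) b a ↔ strictIn (w (coeP q)) b a))

theorem WeakOrder.rel_iff_not_strict {A : Type*} (r : WeakOrder A) (a b : A) :
    r.rel a b ↔ ¬ r.strict b a := by
  have h := r.total a b
  unfold WeakOrder.strict
  tauto

theorem strLE_antisymm {A : Type*} {r s : WeakOrder A} (hrs : strLE r s) (hsr : strLE s r) :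
    r = s := by
  have h : r.rel = s.rel := by
    funext a b
    rw [eq_iff_iff, r.rel_iff_not_strict, s.rel_iff_not_strict]
    exact not_congr ⟨hsr b a, hrs b a⟩
  cases r
  cases s
  cases h
  rfl

theorem strLE_indiff {A : Type*} (r : WeakOrder A) : strLE r (indiff A) :=
  fun _ _ h => (h.2 trivial).elim

theorem isLUBw_wsup {A : Type*} {r s : WeakOrder A} (h : ∃ t, IsLUBw r s t) :
    IsLUBw r s (wsup r s) := by
  rw [wsup, dif_pos h]
  exact h.choose_spec

theorem wsup_eq_left {A : Type*} {r s : WeakOrder A} (h : strLE s r) : wsup r s = r := by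
  have hr : IsLUBw r s r := ⟨fun _ _ => id, h, fun _ hu _ => hu⟩
  have hsup := isLUBw_wsup ⟨r, hr⟩
  exact strLE_antisymm (hsup.2.2 r hr.1 hr.2.1) hsup.1

theorem strLE_wsup_right {A : Type*} (r s : WeakOrder A) : strLE s (wsup r s) := by
  by_cases h : ∃ t, IsLUBw r s t
  · exact (isLUBw_wsup h).2.1
  · rw [wsup, dif_neg h]
    exact strLE_indiff s

theorem pjoin_eq_left_iff {A : Type*} (r : WeakOrder A) (x : Pbar A) :
    pjoin (some r) x = some r ↔
      (x = none → r = indiff A) ∧ (r ≠ indiff A → barLE x (some r)) := by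
  cases x with
  | none => simp [pjoin, barLE, eq_comm]
  | some s =>
    simp only [pjoin, barLE, Option.some.injEq, reduceCtorEq, false_implies, true_and]
    constructor
    · intro h _
      simpa only [h] using strLE_wsup_right r s
    · intro h
      refine wsup_eq_left ?_
      by_cases hr : r = indiff A
      · exact hr ▸ strLE_indiff s
      · exact h hr

/-- In the Self-Reference System `(w, +_i)` (where
`p ∗ q` replaces coordinate `i` of `p` by `p_i + w(q)`), `w` has a dictator at
`i` iff every profile `p ∈ P^N` satisfies the fixed-point property by itself:
`p ∗ p = p`. -/
theorem dictator_iff_fixed_point {A : Type*} {N : ℕ}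
    (w : (Fin N → Pbar A) → Pbar A) (i : Fin N) :
    HasDictatorAt w i ↔
      ∀ p : Fin N → WeakOrder A,
        Function.update (coeP p) i (pjoin (some (p i)) (w (coeP p))) = coeP p := by
  refine forall_congr' fun p => ?_
  rw [Function.update_eq_self_iff]
  exact (pjoin_eq_left_iff (p i) (w (coeP p))).symm
end

section
/- In the Self-Reference System (w, Ω_i), the i-th indicator Υ_i is a diagonaliser restricted to the domain P^N (i.e., Υ_i ∗ p = p ∗ p for every p ∈ P^N) if and only if w(p) ≤ p_i in the extended strictness ordering for every p ∈ P^N. -/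
theorem barLE_refl {A : Type*} (r : Pbar A) : barLE r r := by
  cases r with
  | none => trivial
  | some r => exact fun _ _ h => h

theorem barLE_antisymm {A : Type*} {r s : Pbar A} (hrs : barLE r s) (hsr : barLE s r) :
    r = s := by
  cases r <;> cases s
  · rfl
  · exact hsr.elim
  · exact hrs.elim
  · exact congrArg some (strLE_antisymm hrs hsr)

theorem barLE_indiff {A : Type*} (r : Pbar A) : barLE r (some (indiff A)) := by
  cases r with
  | none => trivial
  | some r => exact fun _ _ h => (h.2 trivial).elim

theorem pinf_eq_right_iff {A : Type*} {r s : Pbar A} : pinf r s = s ↔ barLE s r := by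
  constructor
  · intro h
    by_cases hex : ∃ t, IsGLBbar r s t
    · rw [pinf, dif_pos hex] at h
      exact h ▸ hex.choose_spec.1
    · rw [pinf, dif_neg hex] at h
      subst h
      trivial
  · intro h
    have hex : ∃ t, IsGLBbar r s t := ⟨s, h, barLE_refl s, fun _ _ hu => hu⟩
    rw [pinf, dif_pos hex]
    exact barLE_antisymm hex.choose_spec.2.1 (hex.choose_spec.2.2 s h (barLE_refl s))

theorem Omega_eq_Omega_iff {A : Type*} {N : ℕ} {i : Fin N} {p q : Fin N → Pbar A}
    {r s : Pbar A} : Omega i p r = Omega i q s ↔ pinf (p i) r = pinf (q i) s := by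
  constructor
  · intro h
    simpa [Omega] using congrFun h i
  · intro h
    funext j
    simp only [Omega, h]

/-- In the Self-Reference System `(w, Ω_i)`, the `i`-th
indicator `Υ_i` is a diagonaliser restricted to the domain `P^N`
(`Υ_i ∗ p = p ∗ p` for every `p ∈ P^N`) iff `w(p) ≤ p_i` for every `p ∈ P^N`. -/
theorem indicator_diagonaliser_iff {A : Type*} {N : ℕ}
    (w : (Fin N → Pbar A) → Pbar A) (i : Fin N) :
    (∀ p : Fin N → WeakOrder A,
        starOmega w i (indicator i) (coeP p) = starOmega w i (coeP p) (coeP p)) ↔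
      ∀ p : Fin N → WeakOrder A, barLE (w (coeP p)) (some (p i)) := by
  refine forall_congr' fun p => ?_
  have hi : indicator (A := A) i i = some (indiff A) := if_pos rfl
  rw [starOmega, starOmega, Omega_eq_Omega_iff, hi, pinf_eq_right_iff.2 (barLE_indiff _),
    eq_comm, pinf_eq_right_iff]
  rfl
end

section
/- For weak orders r and s on 𝒜, the transitive closure of the union r ∪ s (as binary relations) is itself a weak order, and it is the least upper bound of r and s in the strictness ordering on P. -/
/-- The strictness ordering is inclusion of the underlying relations. -/
theorem strLE_iff_rel_imp {A : Type*} {r s : WeakOrder A} :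
    strLE r s ↔ ∀ a b, r.rel a b → s.rel a b := by
  constructor
  · intro h a b hab
    by_contra hs
    exact (h b a ⟨(s.total a b).resolve_left hs, hs⟩).2 hab
  · intro h a b hab
    have hr : ¬ r.rel b a := fun hba => hab.2 (h b a hba)
    exact ⟨(r.total a b).resolve_right hr, hr⟩

/-- The transitive closure of the union of two weak orders, as a weak order. -/
def WeakOrder.transGenUnion {A : Type*} (r s : WeakOrder A) : WeakOrder A where
  rel := Relation.TransGen (fun a b => r.rel a b ∨ s.rel a b)
  trans _ _ _ := Relation.TransGen.trans
  total a b := (r.total a b).imp (fun h => .single (.inl h)) (fun h => .single (.inl h))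

/-- For weak orders `r`, `s` on `𝒜`, the transitive closure
of the union `r ∪ s` is itself a weak order, and it is the least upper bound of
`r` and `s` in the strictness ordering on `P`. -/
theorem transClosure_union_isLUB {A : Type*} (r s : WeakOrder A) :
    ∃ t : WeakOrder A,
      t.rel = Relation.TransGen (fun a b => r.rel a b ∨ s.rel a b) ∧
      IsLUBw r s t := by
  refine ⟨r.transGenUnion s, rfl, ?_, ?_, ?_⟩
  · exact strLE_iff_rel_imp.2 fun _ _ h => .single (.inl h)
  · exact strLE_iff_rel_imp.2 fun _ _ h => .single (.inr h)
  · intro u hr hs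
    rw [strLE_iff_rel_imp] at hr hs ⊢
    intro a b hab
    induction hab with
    | single h => exact h.elim (hr _ _) (hs _ _)
    | tail _ h ih => exact u.trans _ _ _ ih (h.elim (hr _ _) (hs _ _))
end

section
/- For weak orders r and s on 𝒜: if t is a greatest lower bound of r and s in the strictness ordering on P, then t equals the intersection r ∩ s (as binary relations on 𝒜). -/
namespace WeakOrder

variable {A B : Type*}

/-- The pullback of a weak order along a map. -/
def comap (f : B → A) (r : WeakOrder A) : WeakOrder B :=
  ⟨fun x y => r.rel (f x) (f y), fun _ _ _ => r.trans _ _ _, fun _ _ => r.total _ _⟩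

theorem rel_refl (r : WeakOrder A) (a : A) : r.rel a a := (r.total a a).elim id id

/-- A map moving every alternative within its indifference class preserves the weak order. -/
theorem comap_rel_iff (r : WeakOrder A) {f : A → A}
    (hf : ∀ x, r.rel x (f x) ∧ r.rel (f x) x) (x y : A) :
    (r.comap f).rel x y ↔ r.rel x y :=
  ⟨fun h => r.trans _ _ _ (hf x).1 (r.trans _ _ _ h (hf y).2),
    fun h => r.trans _ _ _ (hf x).2 (r.trans _ _ _ h (hf y).1)⟩

theorem rel_of_strLE {r t : WeakOrder A} (h : strLE t r) {a b : A} (hab : t.rel a b) :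
    r.rel a b := by
  by_contra hr
  exact (h b a ⟨(r.total a b).resolve_left hr, hr⟩).2 hab

theorem comap_strLE {r t : WeakOrder A} (h : strLE t r) {f : A → A}
    (hf : ∀ x, r.rel x (f x) ∧ r.rel (f x) x) : strLE (t.comap f) r := fun x y hxy =>
  h _ _ ⟨(r.comap_rel_iff hf x y).2 hxy.1, fun hyx => hxy.2 ((r.comap_rel_iff hf y x).1 hyx)⟩

open Classical in
theorem rel_swap (r : WeakOrder A) {a b : A} (hab : r.rel a b) (hba : r.rel b a) (x : A) :
    r.rel x (Equiv.swap a b x) ∧ r.rel (Equiv.swap a b x) x := by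
  rw [Equiv.swap_apply_def]
  split_ifs with hxa hxb
  · exact hxa ▸ ⟨hab, hba⟩
  · exact hxb ▸ ⟨hba, hab⟩
  · exact ⟨r.rel_refl x, r.rel_refl x⟩

end WeakOrder

/-- If `t` is a greatest lower bound of weak orders `r` and
`s` in the strictness ordering on `P`, then `t` equals the intersection
`r ∩ s` as binary relations on `𝒜`. -/
theorem glb_eq_intersection {A : Type*} (r s t : WeakOrder A) (h : IsGLBw r s t) :
    ∀ a b : A, t.rel a b ↔ (r.rel a b ∧ s.rel a b) := by
  classical
  obtain ⟨hr, hs, hglb⟩ := h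
  refine fun a b => ⟨fun hab => ⟨WeakOrder.rel_of_strLE hr hab, WeakOrder.rel_of_strLE hs hab⟩,
    fun ⟨hrab, hsab⟩ => ?_⟩
  by_contra hab
  have hba : t.rel b a := (t.total a b).resolve_left hab
  -- Exchanging `a` and `b` in `t` gives a lower bound that is not below `t`.
  have hu : strLE (t.comap (Equiv.swap a b)) t := hglb _
    (WeakOrder.comap_strLE hr (r.rel_swap hrab (WeakOrder.rel_of_strLE hr hba)))
    (WeakOrder.comap_strLE hs (s.rel_swap hsab (WeakOrder.rel_of_strLE hs hba)))
  have hswap : (t.comap (Equiv.swap a b)).rel b a := (hu b a ⟨hba, hab⟩).1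
  simp only [WeakOrder.comap, Equiv.swap_apply_left, Equiv.swap_apply_right] at hswap
  exact hab hswap
end

section
/- The extended strictness order (P̄, ≤) has all binary greatest lower bounds: for all r, s ∈ P̄ there exists a greatest lower bound r ⊓ s in (P̄, ≤). -/
namespace WeakOrder

theorem rel_iff_not_strict_s13 {A : Type*} (r : WeakOrder A) (a b : A) :
    r.rel a b ↔ ¬ r.strict b a := by
  have := r.total a b
  simp only [strict]
  tauto

end WeakOrder

/-- `r ≤ s` in the strictness ordering iff `r` is contained in `s` as a relation. -/
theorem strLE_iff_rel {A : Type*} (r s : WeakOrder A) :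
    strLE r s ↔ ∀ a b, r.rel a b → s.rel a b := by
  simp only [WeakOrder.rel_iff_not_strict_s13, not_imp_not]
  exact forall_comm

/-- The intersection of two weak orders, provided that it is complete. -/
def WeakOrder.inter {A : Type*} (r s : WeakOrder A)
    (h : ∀ a b, (r.rel a b ∧ s.rel a b) ∨ (r.rel b a ∧ s.rel b a)) : WeakOrder A :=
  ⟨fun a b => r.rel a b ∧ s.rel a b,
    fun a b c h₁ h₂ => ⟨r.trans a b c h₁.1 h₂.1, s.trans a b c h₁.2 h₂.2⟩, h⟩

/-- The extended strictness order `(P̄, ≤)` has all binary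
greatest lower bounds. -/
theorem pbar_has_binary_glbs {A : Type*} :
    ∀ r s : Pbar A, ∃ t : Pbar A, IsGLBbar r s t := by
  rintro (_ | r) (_ | s)
  · exact ⟨none, trivial, trivial, fun _ h _ => h⟩
  · exact ⟨none, trivial, trivial, fun _ h _ => h⟩
  · exact ⟨none, trivial, trivial, fun _ _ h => h⟩
  by_cases h : ∀ a b, (r.rel a b ∧ s.rel a b) ∨ (r.rel b a ∧ s.rel b a)
  · refine ⟨some (r.inter s h), (strLE_iff_rel _ _).2 fun _ _ hab => hab.1,
      (strLE_iff_rel _ _).2 fun _ _ hab => hab.2, ?_⟩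
    rintro (_ | u) hr hs
    · trivial
    · exact (strLE_iff_rel _ _).2 fun a b hab =>
        ⟨(strLE_iff_rel u r).1 hr a b hab, (strLE_iff_rel u s).1 hs a b hab⟩
  · refine ⟨none, trivial, trivial, ?_⟩
    rintro (_ | u) hr hs
    · trivial
    · refine h fun a b => (u.total a b).imp ?_ ?_ <;>
        exact fun hab => ⟨(strLE_iff_rel u r).1 hr _ _ hab, (strLE_iff_rel u s).1 hs _ _ hab⟩
end

section
/- Arrow's Impossibility Theorem (classical form): Let 𝒜 be finite with at least 3 elements and let N ≥ 2. If a Social Welfare Function w : P^N → P satisfies Unanimity and Independence of Irrelevant Alternatives, then w has a dictator: there exists an individual i such that for every profile p ∈ P^N and all alternatives a, b, if a ≺ b in p_i then a ≺ b in w(p). -/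
/-- Unanimity for a classical Social Welfare Function `w : P^N → P`. -/
def UnanimityC {A : Type*} {N : ℕ} (w : (Fin N → WeakOrder A) → WeakOrder A) : Prop :=
  ∀ (p : Fin N → WeakOrder A) (a b : A),
    (∀ j, (p j).strict a b) → (w p).strict a b

/-- Independence of Irrelevant Alternatives for a classical Social Welfare
Function `w : P^N → P`. -/
def IIAC {A : Type*} {N : ℕ} (w : (Fin N → WeakOrder A) → WeakOrder A) : Prop :=
  ∀ (p q : Fin N → WeakOrder A) (a b : A),
    (∀ j, ((p j).strict a b ↔ (q j).strict a b) ∧ ((p j).strict b a ↔ (q j).strict b a)) →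
    (((w p).strict a b ↔ (w q).strict a b) ∧ ((w p).strict b a ↔ (w q).strict b a))

namespace WeakOrder

variable {A : Type*}

/-- The weak order in which `x` is below `y` when `f x ≤ f y`. -/
def ofRank (f : A → ℕ) : WeakOrder A :=
  ⟨fun a b => f a ≤ f b, fun _ _ _ => le_trans, fun _ _ => le_total _ _⟩

theorem strict_ofRank {f : A → ℕ} {a b : A} : (ofRank f).strict a b ↔ f a < f b := by
  simp only [strict, ofRank]
  omega

theorem strict.trans {r : WeakOrder A} {a b c : A} (hab : r.strict a b) (hbc : r.strict b c) :
    r.strict a c :=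
  ⟨r.trans _ _ _ hab.1 hbc.1, fun h => hab.2 (r.trans _ _ _ hbc.1 h)⟩

theorem strict.asymm {r : WeakOrder A} {a b : A} (hab : r.strict a b) : ¬ r.strict b a :=
  fun h => h.2 hab.1

theorem strict.strict_or {r : WeakOrder A} {a b : A} (hab : r.strict a b) (c : A) :
    r.strict a c ∨ r.strict c b := by
  by_cases h : r.rel c a
  · exact .inr ⟨r.trans _ _ _ h hab.1, fun h' => hab.2 (r.trans _ _ _ h' h)⟩
  · exact .inl ⟨(r.total a c).resolve_right h, h⟩

end WeakOrder

section Decisive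

variable {A : Type*} {N : ℕ} {w : (Fin N → WeakOrder A) → WeakOrder A} {S : Finset (Fin N)}
  {a b c : A}

/-- The coalition `S` imposes its preference `a ≺ b`. -/
def DecisiveFor (w : (Fin N → WeakOrder A) → WeakOrder A) (S : Finset (Fin N)) (a b : A) : Prop :=
  ∀ p : Fin N → WeakOrder A, (∀ j ∈ S, (p j).strict a b) → (w p).strict a b

/-- The coalition `S` imposes its preference `a ≺ b` when everybody else prefers `b ≺ a`. -/
def AlmostDecisiveFor (w : (Fin N → WeakOrder A) → WeakOrder A) (S : Finset (Fin N)) (a b : A) :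
    Prop :=
  ∀ p : Fin N → WeakOrder A, (∀ j ∈ S, (p j).strict a b) → (∀ j ∉ S, (p j).strict b a) →
    (w p).strict a b

/-- The coalition `S` imposes each of its strict preferences. -/
def Decisive (w : (Fin N → WeakOrder A) → WeakOrder A) (S : Finset (Fin N)) : Prop :=
  ∀ a b : A, a ≠ b → DecisiveFor w S a b

theorem DecisiveFor.almost (h : DecisiveFor w S a b) : AlmostDecisiveFor w S a b :=
  fun p hp _ => h p hp

theorem exists_ranks (hab : a ≠ b) (hac : a ≠ c) (hbc : b ≠ c) (ra rb rc : Fin N → ℕ) :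
    ∃ f : Fin N → A → ℕ, ∀ j, f j a = ra j ∧ f j b = rb j ∧ f j c = rc j := by
  classical
  exact ⟨fun j x => if x = a then ra j else if x = b then rb j else rc j, fun j => by
    simp [hab.symm, hac.symm, hbc.symm]⟩

theorem IIAC.almostDecisiveFor (hI : IIAC w) {p : Fin N → WeakOrder A}
    (hS : ∀ j ∈ S, (p j).strict a b) (hS' : ∀ j ∉ S, (p j).strict b a)
    (hw : (w p).strict a b) : AlmostDecisiveFor w S a b := by
  intro q hq hq'
  refine (hI p q a b fun j => ?_).1.1 hw
  by_cases hj : j ∈ S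
  · simp [hS j hj, hq j hj, (hS j hj).asymm, (hq j hj).asymm]
  · simp [hS' j hj, hq' j hj, (hS' j hj).asymm, (hq' j hj).asymm]

theorem AlmostDecisiveFor.decisiveFor_right (hU : UnanimityC w) (hI : IIAC w)
    (hab : a ≠ b) (hac : a ≠ c) (hbc : b ≠ c) (h : AlmostDecisiveFor w S a b) :
    DecisiveFor w S a c := by
  classical
  intro p hp
  obtain ⟨f, hf⟩ := exists_ranks hab hac hbc
    (fun j => if j ∈ S then 0 else if (p j).strict c a then 2 else 1)
    (fun j => if j ∈ S then 1 else 0)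
    (fun j => if j ∈ S then 2 else if (p j).strict a c then 2 else 1)
  have h₁ : (w fun j => .ofRank (f j)).strict a b := by
    refine h _ (fun j hj => ?_) fun j hj => ?_ <;> rw [WeakOrder.strict_ofRank] <;> grind
  have h₂ : (w fun j => .ofRank (f j)).strict b c := by
    refine hU _ _ _ fun j => ?_
    rw [WeakOrder.strict_ofRank]
    grind
  refine (hI _ p a c fun j => ?_).1.1 (h₁.trans h₂)
  rw [WeakOrder.strict_ofRank, WeakOrder.strict_ofRank]
  have := fun h : (p j).strict a c => h.asymm
  grind

theorem AlmostDecisiveFor.decisiveFor_left (hU : UnanimityC w) (hI : IIAC w)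
    (hab : a ≠ b) (hac : a ≠ c) (hbc : b ≠ c) (h : AlmostDecisiveFor w S a b) :
    DecisiveFor w S c b := by
  classical
  intro p hp
  obtain ⟨f, hf⟩ := exists_ranks hab hac hbc
    (fun j => if j ∈ S then 1 else 2)
    (fun j => if j ∈ S then 2 else if (p j).strict c b then 1 else 0)
    (fun j => if j ∈ S then 0 else if (p j).strict b c then 1 else 0)
  have h₁ : (w fun j => .ofRank (f j)).strict a b := by
    refine h _ (fun j hj => ?_) fun j hj => ?_ <;> rw [WeakOrder.strict_ofRank] <;> grind
  have h₂ : (w fun j => .ofRank (f j)).strict c a := by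
    refine hU _ _ _ fun j => ?_
    rw [WeakOrder.strict_ofRank]
    grind
  refine (hI _ p c b fun j => ?_).1.1 (h₂.trans h₁)
  rw [WeakOrder.strict_ofRank, WeakOrder.strict_ofRank]
  have := fun h : (p j).strict c b => h.asymm
  grind

/-- Field expansion: a coalition almost decisive for one pair is decisive. -/
theorem AlmostDecisiveFor.decisive (hU : UnanimityC w) (hI : IIAC w)
    (hab : a ≠ b) (hac : a ≠ c) (hbc : b ≠ c) (h : AlmostDecisiveFor w S a b) :
    Decisive w S := by
  have hac' : DecisiveFor w S a c := h.decisiveFor_right hU hI hab hac hbc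
  have hbc' : DecisiveFor w S b c := hac'.almost.decisiveFor_left hU hI hac hab hbc.symm
  intro x y hxy
  by_cases hxb : x = b
  · subst hxb
    by_cases hyc : y = c
    · exact hyc ▸ hbc'
    · exact hbc'.almost.decisiveFor_right hU hI hbc hxy (Ne.symm hyc)
  · have hxb' : AlmostDecisiveFor w S x b := by
      by_cases hxa : x = a
      · exact hxa ▸ h
      · exact (h.decisiveFor_left hU hI hab (Ne.symm hxa) (Ne.symm hxb)).almost
    by_cases hyb : y = b
    · subst hyb
      by_cases hxa : x = a
      · subst hxa
        exact hac'.almost.decisiveFor_right hU hI hac hab hbc.symm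
      · exact h.decisiveFor_left hU hI hab (Ne.symm hxa) (Ne.symm hxb)
    · exact hxb'.decisiveFor_right hU hI hxb hxy (Ne.symm hyb)

/-- Group contraction: a decisive coalition splits into a member and the rest,
one of which is decisive. -/
theorem Decisive.singleton_or (hU : UnanimityC w) (hI : IIAC w)
    (hab : a ≠ b) (hac : a ≠ c) (hbc : b ≠ c) {i : Fin N} (hi : i ∉ S)
    (h : Decisive w (insert i S)) : Decisive w {i} ∨ Decisive w S := by
  classical
  obtain ⟨f, hf⟩ := exists_ranks hab hac hbc
    (fun j => if j = i then 0 else if j ∈ S then 1 else 2)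
    (fun j => if j = i then 1 else if j ∈ S then 2 else 0)
    (fun j => if j = i then 2 else if j ∈ S then 0 else 1)
  have h₁ : (w fun j => .ofRank (f j)).strict a b := by
    refine h a b hab _ fun j hj => ?_
    rw [WeakOrder.strict_ofRank]
    grind
  refine (h₁.strict_or c).imp (fun h₂ => ?_) fun h₂ => ?_
  · refine (hI.almostDecisiveFor (fun j hj => ?_) (fun j hj => ?_) h₂).decisive hU hI
      hac hab hbc.symm <;> rw [WeakOrder.strict_ofRank] <;> grind
  · refine (hI.almostDecisiveFor (fun j hj => ?_) (fun j hj => ?_) h₂).decisive hU hI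
      hbc.symm hac.symm hab.symm <;> rw [WeakOrder.strict_ofRank] <;> grind

theorem Decisive.exists_singleton (hU : UnanimityC w) (hI : IIAC w)
    (hab : a ≠ b) (hac : a ≠ c) (hbc : b ≠ c) (h : Decisive w S) :
    ∃ i, Decisive w {i} := by
  classical
  induction S using Finset.induction_on with
  | empty =>
    have hd := fun x y hxy => h x y hxy (fun _ => indiff A) (by simp)
    exact absurd (hd b a hab.symm) (hd a b hab).asymm
  | insert i S hi ih =>
    exact (h.singleton_or hU hI hab hac hbc hi).elim (fun h' => ⟨i, h'⟩) ih

end Decisive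

/-- **Arrow's Impossibility Theorem, classical form.** If `𝒜` is
finite with at least 3 elements, `N ≥ 2`, and `w : P^N → P` satisfies Unanimity
and IIA, then `w` has a dictator. -/
theorem arrow_classical {A : Type*} [Finite A] (hA : 3 ≤ Nat.card A)
    {N : ℕ} (hN : 2 ≤ N) (w : (Fin N → WeakOrder A) → WeakOrder A)
    (hU : UnanimityC w) (hIIA : IIAC w) :
    ∃ i : Fin N, ∀ (p : Fin N → WeakOrder A) (a b : A),
      (p i).strict a b → (w p).strict a b := by
  have := Fintype.ofFinite A
  rw [Nat.card_eq_fintype_card] at hA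
  obtain ⟨a, b, c, hab, hac, hbc⟩ := Fintype.two_lt_card_iff.1 hA
  have hd : Decisive w Finset.univ := fun x y _ p hp => hU p x y fun j => hp j (Finset.mem_univ j)
  obtain ⟨i, hi⟩ := hd.exists_singleton hU hIIA hab hac hbc
  refine ⟨i, fun p x y hxy => hi x y ?_ p (by simpa using hxy)⟩
  rintro rfl
  exact hxy.asymm hxy
end
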